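/- Let d ≥ 2 be an integer and let (a_n)_{n∈ℕ} be a strictly decreasing sequence of positive reals converging to 0. Then for every θ ∈ (0,1], lodim_θ(C^d({a_n})) ≥ d · lodim_θ({a_n : n ∈ ℕ}) and updim_θ(C^d({a_n})) ≥ d · updim_θ({a_n : n ∈ ℕ}). -/

import Mathlib

open Set Metric Filter

/-- The upper θ-intermediate dimension of a set `E` in a metric space:
the infimum of all `s ≥ 0` such that for every `ε > 0` there is `δ₀ > 0` such that for all
`0 < δ < δ₀` there is a countable cover `𝒰` of `E` with `δ ≤ diam U ≤ δ ^ θ` for all `U ∈ 𝒰`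
and `∑_{U ∈ 𝒰} (diam U) ^ s ≤ ε`. -/
noncomputable def updim {X : Type*} [PseudoMetricSpace X] (θ : ℝ) (E : Set X) : ℝ :=
  sInf {s : ℝ | 0 ≤ s ∧ ∀ ε : ℝ, 0 < ε → ∃ δ₀ : ℝ, 0 < δ₀ ∧ ∀ δ : ℝ, 0 < δ → δ < δ₀ →
    ∃ 𝒰 : Set (Set X), 𝒰.Countable ∧ E ⊆ ⋃₀ 𝒰 ∧
      (∀ U ∈ 𝒰, δ ≤ diam U ∧ diam U ≤ δ ^ θ) ∧
      ∑' U : 𝒰, ENNReal.ofReal (diam (U : Set X) ^ s) ≤ ENNReal.ofReal ε}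

/-- The lower θ-intermediate dimension of a set `E` in a metric space. -/
noncomputable def lodim {X : Type*} [PseudoMetricSpace X] (θ : ℝ) (E : Set X) : ℝ :=
  sInf {s : ℝ | 0 ≤ s ∧ ∀ ε : ℝ, 0 < ε → ∀ δ₀ : ℝ, 0 < δ₀ → ∃ δ : ℝ, 0 < δ ∧ δ < δ₀ ∧
    ∃ 𝒰 : Set (Set X), 𝒰.Countable ∧ E ⊆ ⋃₀ 𝒰 ∧
      (∀ U ∈ 𝒰, δ ≤ diam U ∧ diam U ≤ δ ^ θ) ∧
      ∑' U : 𝒰, ENNReal.ofReal (diam (U : Set X) ^ s) ≤ ENNReal.ofReal ε}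

/-- `C^d({a_n})`: the union over `n` of the spheres in `ℝ^d` of radius `a n` centred at
the origin. -/
noncomputable def concentricSeq (d : ℕ) (a : ℕ → ℝ) : Set (EuclideanSpace ℝ (Fin d)) :=
  {x | ∃ n : ℕ, ‖x‖ = a n}

/-- Existence of an admissible cover at scale `δ` of cost at most `ε`. -/
def Cov {X : Type*} [PseudoMetricSpace X] (θ : ℝ) (E : Set X) (s δ ε : ℝ) : Prop :=
  ∃ 𝒰 : Set (Set X), 𝒰.Countable ∧ E ⊆ ⋃₀ 𝒰 ∧
      (∀ U ∈ 𝒰, δ ≤ diam U ∧ diam U ≤ δ ^ θ) ∧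
      ∑' U : 𝒰, ENNReal.ofReal (diam (U : Set X) ^ s) ≤ ENNReal.ofReal ε

lemma Cov.of_family {X : Type*} [PseudoMetricSpace X] {θ : ℝ} {E : Set X} {s δ ε : ℝ}
    {ι : Type*} [Countable ι] (V : ι → Set X) (hc : ∀ x ∈ E, ∃ i, x ∈ V i)
    (hb : ∀ i, δ ≤ diam (V i) ∧ diam (V i) ≤ δ ^ θ)
    (hs : ∑' i, ENNReal.ofReal (diam (V i) ^ s) ≤ ENNReal.ofReal ε) : Cov θ E s δ ε := by
  refine ⟨Set.range V, Set.countable_range V, ?_, ?_, ?_⟩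
  · intro x hx
    obtain ⟨i, hi⟩ := hc x hx
    exact ⟨V i, ⟨i, rfl⟩, hi⟩
  · rintro _ ⟨i, rfl⟩
    exact hb i
  · refine le_trans ?_ hs
    exact ENNReal.tsum_le_tsum_comp_of_surjective (Set.rangeFactorization_surjective (f := V))
      (fun U : Set.range V => ENNReal.ofReal (diam (U : Set X) ^ s))

lemma Cov.union {X : Type*} [PseudoMetricSpace X] {θ : ℝ} {E F G : Set X} {s δ ε₁ ε₂ ε : ℝ}
    (h1 : Cov θ E s δ ε₁) (h2 : Cov θ F s δ ε₂) (he1 : 0 ≤ ε₁) (he2 : 0 ≤ ε₂)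
    (hG : G ⊆ E ∪ F) (he : ε₁ + ε₂ ≤ ε) : Cov θ G s δ ε := by
  obtain ⟨A, hA, hA1, hA2, hA3⟩ := h1
  obtain ⟨B, hB, hB1, hB2, hB3⟩ := h2
  refine ⟨A ∪ B, hA.union hB, ?_, ?_, ?_⟩
  · rw [Set.sUnion_union]
    exact hG.trans (Set.union_subset_union hA1 hB1)
  · rintro U (h | h)
    · exact hA2 U h
    · exact hB2 U h
  · refine (ENNReal.tsum_union_le (fun U : Set X => ENNReal.ofReal (diam U ^ s)) A B).trans ?_
    refine (add_le_add hA3 hB3).trans ?_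
    rw [← ENNReal.ofReal_add he1 he2]
    exact ENNReal.ofReal_le_ofReal he

/-- Covering an interval by pieces of maximal size. -/
lemma cov_interval {θ δ R t : ℝ} (hδ : 0 < δ) (hδ1 : δ < 1) (hθ' : θ ≤ 1) (hR : 0 ≤ R)
    {F : Set ℝ} (hF : ∀ x ∈ F, 0 ≤ x ∧ x ≤ R) :
    Cov θ F t δ ((R / δ ^ θ + 1) * (δ ^ θ) ^ t) := by
  have hη : 0 < δ ^ θ := Real.rpow_pos_of_pos hδ _
  have hδη : δ ≤ δ ^ θ := by
    simpa using Real.rpow_le_rpow_of_exponent_ge hδ hδ1.le hθ'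
  set η := δ ^ θ
  have hd : ∀ k : Fin (⌊R / η⌋₊ + 1), diam (Set.Icc ((k : ℕ) * η) ((k : ℕ) * η + η)) = η := by
    intro k
    rw [Real.diam_Icc (by linarith)]; ring
  refine Cov.of_family (ι := Fin (⌊R / η⌋₊ + 1))
    (fun k => Set.Icc ((k : ℕ) * η) ((k : ℕ) * η + η)) ?_ ?_ ?_
  · intro x hx
    obtain ⟨h0, h1⟩ := hF x hx
    refine ⟨⟨⌊x / η⌋₊, Nat.lt_succ_of_le (Nat.floor_le_floor (by gcongr))⟩, ?_, ?_⟩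
    · have := Nat.floor_le (div_nonneg h0 hη.le)
      rwa [le_div_iff₀ hη] at this
    · have := (Nat.lt_floor_add_one (x / η)).le
      rw [div_le_iff₀ hη] at this
      simp only
      linarith
  · intro k
    rw [hd k]; exact ⟨hδη, le_rfl⟩
  · simp only [hd]
    rw [tsum_fintype, Finset.sum_const, Finset.card_univ, Fintype.card_fin, nsmul_eq_mul,
      ← ENNReal.ofReal_natCast, ← ENNReal.ofReal_mul (by positivity)]
    apply ENNReal.ofReal_le_ofReal
    have := Nat.floor_le (div_nonneg hR hη.le)
    push_cast
    gcongr

/-- The (unnormalised) direction. -/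
noncomputable def dirv {m : ℕ} (y : Fin m → ℝ) : EuclideanSpace ℝ (Fin (m + 1)) :=
  WithLp.toLp 2 (Fin.cons 1 y : Fin (m + 1) → ℝ)

lemma dirv_zero {m : ℕ} (y : Fin m → ℝ) : dirv y 0 = 1 := by simp [dirv]
lemma dirv_succ {m : ℕ} (y : Fin m → ℝ) (i : Fin m) : dirv y i.succ = y i := by simp [dirv]

lemma abs_coord_le {n : ℕ} (x : EuclideanSpace ℝ (Fin n)) (i : Fin n) : |x i| ≤ ‖x‖ := by
  simpa using PiLp.norm_apply_le x i

lemma norm_le_of_coord {n : ℕ} (x : EuclideanSpace ℝ (Fin n)) {b : ℝ} (hb : 0 ≤ b)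
    (h : ∀ i, |x i| ≤ b) : ‖x‖ ≤ (n + 1) * b := by
  rw [EuclideanSpace.norm_eq]
  apply Real.sqrt_le_iff.2
  refine ⟨by positivity, ?_⟩
  calc ∑ i, ‖x i‖ ^ 2 ≤ ∑ i : Fin n, b ^ 2 := by
        apply Finset.sum_le_sum
        intro i _
        have := h i
        rw [Real.norm_eq_abs]
        gcongr
    _ = n * b ^ 2 := by simp
    _ ≤ ((n + 1) * b) ^ 2 := by nlinarith [sq_nonneg b, sq_nonneg ((n : ℝ) * b), (Nat.cast_nonneg n : (0 : ℝ) ≤ n), mul_nonneg (Nat.cast_nonneg n : (0 : ℝ) ≤ n) (sq_nonneg b)]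

lemma one_le_norm_dirv {m : ℕ} (y : Fin m → ℝ) : 1 ≤ ‖dirv y‖ := by
  have := abs_coord_le (dirv y) 0
  simpa [dirv_zero] using this

lemma norm_dirv_le {m : ℕ} (y : Fin m → ℝ) (hy : y ∈ Set.Icc (0 : Fin m → ℝ) 1) :
    ‖dirv y‖ ≤ m + 2 := by
  have := norm_le_of_coord (dirv y) zero_le_one (by
    intro i
    refine Fin.cases ?_ (fun j => ?_) i
    · simp [dirv_zero]
    · rw [dirv_succ, abs_le]
      have h0 := hy.1 j
      have h1 := hy.2 j
      simp at h0 h1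
      constructor <;> linarith)
  push_cast at this
  linarith

/-- Two rays through the same small set are close. -/
lemma ray_close {m : ℕ} {y z : Fin m → ℝ} (hz : z ∈ Set.Icc (0 : Fin m → ℝ) 1)
    {l k q u : ℝ} (hq : 0 < q) (hl : q ≤ l)
    (h : dist (l • dirv y) (k • dirv z) ≤ u) : dist y z ≤ 2 * u / q := by
  have hu : 0 ≤ u := dist_nonneg.trans h
  rw [dist_pi_le_iff (by positivity)]
  intro i
  have h0 := abs_coord_le (l • dirv y - k • dirv z) 0
  have h1 := abs_coord_le (l • dirv y - k • dirv z) i.succ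
  rw [← dist_eq_norm] at h0 h1
  simp only [PiLp.sub_apply, PiLp.smul_apply, dirv_zero, dirv_succ, smul_eq_mul, mul_one] at h0 h1
  replace h0 := h0.trans h
  replace h1 := h1.trans h
  have hz0 := hz.1 i
  have hz1 := hz.2 i
  simp only [Pi.zero_apply, Pi.one_apply] at hz0 hz1
  rw [le_div_iff₀ hq, Real.dist_eq]
  have e : l * (y i - z i) = (l * y i - k * z i) + (k - l) * z i := by ring
  have h3 : |l * (y i - z i)| ≤ 2 * u := by
    rw [e]
    refine (abs_add_le _ _).trans ?_
    rw [abs_mul, abs_sub_comm k l, abs_of_nonneg hz0]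
    nlinarith [abs_nonneg (l - k)]
  rw [abs_mul, abs_of_pos (hq.trans_le hl)] at h3
  nlinarith [abs_nonneg (y i - z i)]

/-- Averaging over directions. -/
lemma exists_dir {m : ℕ} {β : Type*} [Countable β] (w : β → ENNReal) (c : β → Fin m → ℝ)
    (ρ : β → ℝ) (hρ : ∀ b, 0 ≤ ρ b) :
    ∃ y ∈ Set.Icc (0 : Fin m → ℝ) 1,
      ∑' b, (closedBall (c b) (ρ b)).indicator (fun _ => w b) y
        ≤ ∑' b, w b * ENNReal.ofReal ((2 * ρ b) ^ m) := by
  have hvol : MeasureTheory.volume (Set.Icc (0 : Fin m → ℝ) 1) = 1 := by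
    rw [Real.volume_Icc_pi]; simp
  have hm : ∀ b, Measurable ((closedBall (c b) (ρ b)).indicator (fun _ : Fin m → ℝ => w b)) :=
    fun b => measurable_const.indicator measurableSet_closedBall
  obtain ⟨y, hy, hle⟩ := MeasureTheory.exists_le_setLAverage
    (μ := MeasureTheory.volume) (s := Set.Icc (0 : Fin m → ℝ) 1)
    (f := fun y => ∑' b, (closedBall (c b) (ρ b)).indicator (fun _ => w b) y)
    (by rw [hvol]; simp) (by rw [hvol]; simp) (Measurable.ennreal_tsum hm).aemeasurable
  refine ⟨y, hy, hle.trans ?_⟩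
  rw [MeasureTheory.setLAverage_eq, hvol, div_one]
  refine (MeasureTheory.setLIntegral_le_lintegral _ _).trans ?_
  rw [MeasureTheory.lintegral_tsum (fun b => (hm b).aemeasurable)]
  refine ENNReal.tsum_le_tsum fun b => ?_
  rw [MeasureTheory.lintegral_indicator measurableSet_closedBall,
    MeasureTheory.setLIntegral_const, Real.volume_pi_closedBall _ (hρ b)]
  simp

/-- The part of the sequence away from the origin. -/
lemma cov_far {m : ℕ} {a : ℕ → ℝ} (hapos : ∀ n, 0 < a n) {θ t δ r ε' K ε : ℝ}
    (hδ : 0 < δ) (hr : 0 < r) (hK : 0 ≤ K)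
    (hKr : ∀ u : ℝ, 0 < u → u ≤ δ ^ θ → u ^ t * (4 * (m + 2) * u / r) ^ m ≤ K * u ^ ((m + 1 : ℝ) * t))
    (hKε : K * ε' ≤ ε)
    (h : Cov θ (concentricSeq (m + 1) a) ((m + 1 : ℝ) * t) δ ε') :
    Cov θ {x | x ∈ Set.range a ∧ r < x} t δ ε := by
  classical
  obtain ⟨𝒰, hcount, hcov, hdiam, hsum⟩ := h
  have : Countable 𝒰 := hcount.to_subtype
  have hbdd : ∀ U : 𝒰, Bornology.IsBounded (U : Set (EuclideanSpace ℝ (Fin (m + 1)))) := by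
    intro U
    by_contra hU
    have := diam_eq_zero_of_unbounded hU
    have := (hdiam U U.2).1
    linarith
  let hit : (Fin m → ℝ) → 𝒰 → Prop := fun y U =>
    ∃ n, r < a n ∧ (a n / ‖dirv y‖) • dirv y ∈ (U : Set (EuclideanSpace ℝ (Fin (m + 1))))
  have hc : ∀ U : 𝒰, ∃ c : Fin m → ℝ, ∀ y ∈ Set.Icc (0 : Fin m → ℝ) 1, hit y U →
      y ∈ closedBall c (2 * (m + 2) * diam (U : Set (EuclideanSpace ℝ (Fin (m + 1)))) / r) := by
    intro U
    by_cases hex : ∃ c ∈ Set.Icc (0 : Fin m → ℝ) 1, hit c U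
    · obtain ⟨c, hc, n', hn', hcU⟩ := hex
      refine ⟨c, fun y hy hyU => ?_⟩
      obtain ⟨n, hn, hyU⟩ := hyU
      have h1 := dist_le_diam_of_mem (hbdd U) hyU hcU
      have hq : r / (m + 2) ≤ a n / ‖dirv y‖ := by
        have := norm_dirv_le y hy
        have h1 := one_le_norm_dirv y
        have := hapos n
        gcongr
      have := ray_close hc (by positivity) hq h1
      rw [mem_closedBall]
      refine this.trans (le_of_eq ?_)
      field_simp
    · exact ⟨0, fun y hy hyU => (hex ⟨y, hy, hyU⟩).elim⟩
  choose c hc using hc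
  obtain ⟨y, hy, hle⟩ := exists_dir
    (fun U : 𝒰 => ENNReal.ofReal (diam (U : Set (EuclideanSpace ℝ (Fin (m + 1)))) ^ t)) c
    (fun U => 2 * (m + 2) * diam (U : Set (EuclideanSpace ℝ (Fin (m + 1)))) / r)
    (fun U => by have := diam_nonneg (s := (U : Set (EuclideanSpace ℝ (Fin (m + 1))))); positivity)
  have hnn := one_le_norm_dirv y
  let lo : 𝒰 → ℝ := fun U => sInf (norm '' (U : Set (EuclideanSpace ℝ (Fin (m + 1)))))
  have hd : ∀ U : 𝒰, diam (Set.Icc (lo U) (lo U + diam (U : Set (EuclideanSpace ℝ (Fin (m + 1))))))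
      = diam (U : Set (EuclideanSpace ℝ (Fin (m + 1)))) := by
    intro U
    rw [Real.diam_Icc (by linarith [diam_nonneg (s := (U : Set (EuclideanSpace ℝ (Fin (m + 1)))))])]
    ring
  refine Cov.of_family (ι := {U : 𝒰 // hit y U})
    (fun U => Set.Icc (lo U.1) (lo U.1 + diam (U.1 : Set (EuclideanSpace ℝ (Fin (m + 1)))))) ?_ ?_ ?_
  · rintro _ ⟨⟨n, rfl⟩, hn⟩
    have hnorm : ‖(a n / ‖dirv y‖) • dirv y‖ = a n := by
      rw [norm_smul, Real.norm_eq_abs, abs_of_pos (by have := hapos n; positivity)]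
      field_simp
    obtain ⟨U, hU, hxU⟩ := hcov (show (a n / ‖dirv y‖) • dirv y ∈ concentricSeq (m + 1) a from
      ⟨n, hnorm⟩)
    refine ⟨⟨⟨U, hU⟩, n, hn, hxU⟩, ?_, ?_⟩
    · apply csInf_le
      · exact ⟨0, by rintro _ ⟨x, _, rfl⟩; exact norm_nonneg x⟩
      · exact ⟨_, hxU, hnorm⟩
    · have : a n - diam U ≤ lo ⟨U, hU⟩ := by
        apply le_csInf
        · exact ⟨_, _, hxU, rfl⟩
        · rintro _ ⟨x, hx, rfl⟩
          have h1 := dist_le_diam_of_mem (hbdd ⟨U, hU⟩) hxU hx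
          rw [dist_eq_norm] at h1
          have h2 := norm_sub_norm_le ((a n / ‖dirv y‖) • dirv y) x
          rw [hnorm] at h2
          simp only at h1
          linarith
      simp only
      linarith
  · intro U
    rw [hd]
    exact hdiam U.1 U.1.2
  · simp only [hd]
    calc ∑' i : {U : 𝒰 // hit y U}, ENNReal.ofReal (diam (i.1 : Set (EuclideanSpace ℝ (Fin (m + 1)))) ^ t)
        ≤ ∑' i : {U : 𝒰 // hit y U}, (closedBall (c i.1) (2 * (m + 2) * diam (i.1 : Set (EuclideanSpace ℝ (Fin (m + 1)))) / r)).indicator (fun _ => ENNReal.ofReal (diam (i.1 : Set (EuclideanSpace ℝ (Fin (m + 1)))) ^ t)) y := by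
          refine ENNReal.tsum_le_tsum fun i => ?_
          rw [Set.indicator_of_mem (hc i.1 y hy i.2)]
      _ ≤ ∑' i : 𝒰, (closedBall (c i) (2 * (m + 2) * diam (i : Set (EuclideanSpace ℝ (Fin (m + 1)))) / r)).indicator (fun _ => ENNReal.ofReal (diam (i : Set (EuclideanSpace ℝ (Fin (m + 1)))) ^ t)) y :=
          ENNReal.tsum_comp_le_tsum_of_injective Subtype.val_injective
            (fun i : 𝒰 => (closedBall (c i) (2 * (m + 2) * diam (i : Set (EuclideanSpace ℝ (Fin (m + 1)))) / r)).indicator (fun _ => ENNReal.ofReal (diam (i : Set (EuclideanSpace ℝ (Fin (m + 1)))) ^ t)) y)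
      _ ≤ _ := hle
      _ ≤ ∑' i : 𝒰, ENNReal.ofReal K * ENNReal.ofReal (diam (i : Set (EuclideanSpace ℝ (Fin (m + 1)))) ^ ((m + 1 : ℝ) * t)) := by
          refine ENNReal.tsum_le_tsum fun i => ?_
          have h1 := hdiam i i.2
          have h2 := hKr _ (hδ.trans_le h1.1) h1.2
          rw [← ENNReal.ofReal_mul (Real.rpow_nonneg diam_nonneg _), ← ENNReal.ofReal_mul hK]
          apply ENNReal.ofReal_le_ofReal
          refine le_trans (le_of_eq ?_) h2
          congr 2
          ring
      _ = ENNReal.ofReal K * ∑' i : 𝒰, ENNReal.ofReal (diam (i : Set (EuclideanSpace ℝ (Fin (m + 1)))) ^ ((m + 1 : ℝ) * t)) := ENNReal.tsum_mul_left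
      _ ≤ ENNReal.ofReal K * ENNReal.ofReal ε' := by gcongr
      _ = ENNReal.ofReal (K * ε') := (ENNReal.ofReal_mul hK).symm
      _ ≤ ENNReal.ofReal ε := ENNReal.ofReal_le_ofReal hKε

lemma rpow_small {p c : ℝ} (hp : 0 < p) (hc : 0 < c) :
    ∃ δ₁ : ℝ, 0 < δ₁ ∧ δ₁ ≤ 1 ∧ ∀ δ, 0 < δ → δ < δ₁ → δ ^ p ≤ c := by
  refine ⟨min 1 (c ^ (1 / p)), lt_min one_pos (Real.rpow_pos_of_pos hc _), min_le_left _ _, ?_⟩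
  intro δ h0 h1
  have h2 : δ ≤ c ^ (1 / p) := h1.le.trans (min_le_right _ _)
  calc δ ^ p ≤ (c ^ (1 / p)) ^ p := Real.rpow_le_rpow h0.le h2 hp.le
    _ = c := by rw [← Real.rpow_mul hc.le, one_div_mul_cancel hp.ne', Real.rpow_one]

lemma key {m : ℕ} {a : ℕ → ℝ} (ha : StrictAnti a) (hapos : ∀ n, 0 < a n) {θ : ℝ} (hθ : 0 < θ)
    (hθ' : θ ≤ 1) {t ε : ℝ} (ht : 0 ≤ t) (hε : 0 < ε) :
    ∃ ε' : ℝ, 0 < ε' ∧ ∃ δ₁ : ℝ, 0 < δ₁ ∧ ∀ δ, 0 < δ → δ < δ₁ →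
      Cov θ (concentricSeq (m + 1) a) ((m + 1 : ℝ) * t) δ ε' → Cov θ (Set.range a) t δ ε := by
  rcases ht.eq_or_lt with rfl | ht
  · refine ⟨1 / 2, by norm_num, 1, one_pos, fun δ _ _ h => ?_⟩
    exfalso
    obtain ⟨𝒰, hcount, hcov, hdiam, hsum⟩ := h
    have : EuclideanSpace.single (0 : Fin (m + 1)) (a 0) ∈ concentricSeq (m + 1) a := by
      refine ⟨0, ?_⟩
      simp [abs_of_pos (hapos 0)]
    obtain ⟨U, hU, _⟩ := hcov this
    have h1 := (ENNReal.le_tsum (f := fun U : 𝒰 => ENNReal.ofReal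
      (diam (U : Set (EuclideanSpace ℝ (Fin (m + 1)))) ^ ((m + 1 : ℝ) * 0))) ⟨U, hU⟩).trans hsum
    rw [mul_zero, Real.rpow_zero, ENNReal.ofReal_le_ofReal_iff (by norm_num)] at h1
    norm_num at h1
  obtain ⟨δa, hδa, hδa1, hsa⟩ := rpow_small (mul_pos hθ ht) (show 0 < ε / 4 by positivity)
  rcases le_or_gt t 1 with ht1 | ht1
  · set K : ℝ := (16 * (m + 2) / ε) ^ m with hKdef
    have hK : 0 < K := by positivity
    refine ⟨ε / 2 / K, by positivity, δa, hδa, fun δ h0 h1 h => ?_⟩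
    have hη : 0 < δ ^ θ := Real.rpow_pos_of_pos h0 _
    have hηt : (δ ^ θ) ^ t ≤ ε / 4 := by rw [← Real.rpow_mul h0.le]; exact hsa δ h0 h1
    set r : ℝ := ε / 4 * (δ ^ θ) ^ (1 - t) with hr
    have hrpos : 0 < r := by positivity
    have hfar : Cov θ {x | x ∈ Set.range a ∧ r < x} t δ (ε / 2) := by
      refine cov_far hapos h0 hrpos hK.le ?_ (le_of_eq (by field_simp)) h
      intro u hu hu1
      have e1 : u = u ^ t * u ^ (1 - t) := by
        rw [← Real.rpow_add hu]; simp
      have e2 : u ^ (1 - t) ≤ (δ ^ θ) ^ (1 - t) := Real.rpow_le_rpow hu.le hu1 (by linarith)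
      have e3 : 4 * (m + 2) * u / r ≤ (16 * (m + 2) / ε) * u ^ t := by
        rw [div_le_iff₀ hrpos, hr]
        have : (16 * (m + 2) / ε) * u ^ t * (ε / 4 * (δ ^ θ) ^ (1 - t))
            = 4 * (m + 2) * (u ^ t * (δ ^ θ) ^ (1 - t)) := by field_simp; ring
        rw [this]
        have : u ≤ u ^ t * (δ ^ θ) ^ (1 - t) := by
          calc u = u ^ t * u ^ (1 - t) := e1
            _ ≤ _ := by gcongr
        gcongr
      calc u ^ t * (4 * (m + 2) * u / r) ^ m ≤ u ^ t * ((16 * (m + 2) / ε) * u ^ t) ^ m := by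
            gcongr
        _ = K * (u ^ t) ^ (m + 1) := by rw [mul_pow]; ring
        _ = K * u ^ ((m + 1 : ℝ) * t) := by
            rw [← Real.rpow_natCast, ← Real.rpow_mul hu.le, mul_comm t]; push_cast; rfl
    have hnear := cov_interval (t := t) h0 (h1.trans_le hδa1) hθ' hrpos.le
      (F := {x | x ∈ Set.range a ∧ x ≤ r}) (by
        rintro _ ⟨⟨n, rfl⟩, hn⟩
        exact ⟨(hapos n).le, hn⟩)
    refine hnear.union hfar (by positivity) (by positivity) ?_ ?_
    · intro x hx
      rcases le_or_gt x r with h | h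
      · exact Or.inl ⟨hx, h⟩
      · exact Or.inr ⟨hx, h⟩
    · have : r / δ ^ θ * (δ ^ θ) ^ t = ε / 4 := by
        rw [hr, Real.rpow_sub hη, Real.rpow_one]
        field_simp
      rw [add_mul, this]
      linarith
  · obtain ⟨δb, hδb, hδb1, hsb⟩ := rpow_small (mul_pos hθ (sub_pos.2 ht1))
      (show 0 < ε / 2 / a 0 by have := hapos 0; positivity)
    refine ⟨1, one_pos, min δa δb, lt_min hδa hδb, fun δ h0 h1 _ => ?_⟩
    have h1a := h1.trans_le (min_le_left _ _)
    have h1b := h1.trans_le (min_le_right _ _)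
    have hη : 0 < δ ^ θ := Real.rpow_pos_of_pos h0 _
    have hηt : (δ ^ θ) ^ t ≤ ε / 4 := by rw [← Real.rpow_mul h0.le]; exact hsa δ h0 h1a
    have hηt1 : (δ ^ θ) ^ (t - 1) ≤ ε / 2 / a 0 := by
      rw [← Real.rpow_mul h0.le]; exact hsb δ h0 h1b
    have hnear := cov_interval (t := t) h0 (h1a.trans_le hδa1) hθ' (hapos 0).le
      (F := Set.range a) (by
        rintro _ ⟨n, rfl⟩
        exact ⟨(hapos n).le, ha.antitone (Nat.zero_le n)⟩)
    have ha0 := hapos 0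
    refine hnear.union (F := (∅ : Set ℝ)) (ε₂ := 0) ⟨∅, by simp, by simp, by simp, by simp⟩
      (by positivity) le_rfl (by simp) ?_
    have e : a 0 / δ ^ θ * (δ ^ θ) ^ t = a 0 * (δ ^ θ) ^ (t - 1) := by
      rw [Real.rpow_sub hη, Real.rpow_one]; ring
    rw [add_mul, e, add_zero]
    have : a 0 * (δ ^ θ) ^ (t - 1) ≤ a 0 * (ε / 2 / a 0) := by gcongr
    have e2 : a 0 * (ε / 2 / a 0) = ε / 2 := by field_simp
    linarith

/-- Some exponent always works for the upper dimension. -/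
lemma up_nonempty {m : ℕ} {a : ℕ → ℝ} (ha : StrictAnti a) (hapos : ∀ n, 0 < a n) {θ : ℝ}
    (hθ : 0 < θ) (hθ' : θ ≤ 1) {ε : ℝ} (hε : 0 < ε) :
    ∃ δ₁ : ℝ, 0 < δ₁ ∧ ∀ δ, 0 < δ → δ < δ₁ →
      Cov θ (concentricSeq (m + 1) a) (m + 2 : ℝ) δ ε := by
  have ha0 := hapos 0
  set D : ℝ := 2 * (m + 2) with hD
  have hDpos : 0 < D := by positivity
  obtain ⟨δa, hδa, hδa1, hsa⟩ := rpow_small hθ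
    (show 0 < ε / (2 * D * a 0 + 3) ^ (m + 1) by positivity)
  refine ⟨δa, hδa, fun δ h0 h1 => ?_⟩
  have hη : 0 < δ ^ θ := Real.rpow_pos_of_pos h0 _
  have hη1 : δ ^ θ ≤ 1 := Real.rpow_le_one h0.le (h1.le.trans hδa1) hθ.le
  have hδη : δ ≤ δ ^ θ := by
    simpa using Real.rpow_le_rpow_of_exponent_ge h0 (h1.le.trans hδa1) hθ'
  have hsmall := hsa δ h0 h1
  set η := δ ^ θ
  set h : ℝ := η / D with hh
  have hpos : 0 < h := by positivity
  set N : ℕ := ⌈a 0 / h⌉₊ with hN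
  have hdiam : ∀ k : Fin (m + 1) → Finset.Icc (-(N : ℤ)) N,
      diam (closedBall (WithLp.toLp 2 (fun i => h * ((k i : ℤ) : ℝ)) : EuclideanSpace ℝ (Fin (m + 1)))
        (η / 2)) = η := by
    intro k
    rw [Metric.diam_closedBall_eq _ (by positivity)]; ring
  refine Cov.of_family (ι := Fin (m + 1) → Finset.Icc (-(N : ℤ)) N)
    (fun k => closedBall (WithLp.toLp 2 (fun i => h * ((k i : ℤ) : ℝ))) (η / 2)) ?_ ?_ ?_
  · rintro x ⟨n, hn⟩
    have hx : ‖x‖ ≤ a 0 := hn ▸ ha.antitone (Nat.zero_le n)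
    have hxi : ∀ i, |x i / h| ≤ N := by
      intro i
      rw [abs_div, abs_of_pos hpos]
      refine le_trans ?_ (Nat.le_ceil _)
      have := (abs_coord_le x i).trans hx
      gcongr
    refine ⟨fun i => ⟨⌊x i / h⌋, ?_⟩, ?_⟩
    · have := abs_le.1 (hxi i)
      rw [Finset.mem_Icc]
      constructor
      · rw [Int.le_floor]; push_cast; exact this.1
      · have := (Int.floor_le (x i / h)).trans this.2
        rw [← Int.cast_natCast (R := ℝ) N] at this
        exact Int.cast_le.1 this
    · rw [mem_closedBall, dist_eq_norm]
      refine (norm_le_of_coord _ hpos.le ?_).trans (le_of_eq ?_)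
      · intro i
        simp only [PiLp.sub_apply]
        have h1 := Int.floor_le (x i / h)
        have h2 := (Int.lt_floor_add_one (x i / h)).le
        rw [le_div_iff₀ hpos] at h1
        rw [div_le_iff₀ hpos] at h2
        rw [abs_le]
        constructor <;> nlinarith
      · rw [hh, hD]; push_cast; field_simp; ring
  · intro k
    rw [hdiam]; exact ⟨hδη, le_rfl⟩
  · simp only [hdiam]
    rw [tsum_fintype, Finset.sum_const, Finset.card_univ, nsmul_eq_mul,
      ← ENNReal.ofReal_natCast, ← ENNReal.ofReal_mul (by positivity)]
    apply ENNReal.ofReal_le_ofReal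
    have hcard : (Fintype.card (Fin (m + 1) → Finset.Icc (-(N : ℤ)) N) : ℝ)
        = (2 * N + 1 : ℝ) ^ (m + 1) := by
      have : (Fintype.card (Fin (m + 1) → Finset.Icc (-(N : ℤ)) N)) = (2 * N + 1) ^ (m + 1) := by
        simp only [Fintype.card_fun, Fintype.card_coe, Int.card_Icc, Fintype.card_fin]
        congr 1
        omega
      rw [this]; push_cast; rfl
    rw [hcard]
    have e1 : η ^ (m + 2 : ℝ) = η ^ (m + 1) * η := by
      rw [← pow_succ, ← Real.rpow_natCast]; push_cast; ring_nf
    have hNle : (N : ℝ) ≤ a 0 / h + 1 := (Nat.ceil_lt_add_one (by positivity)).le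
    have e2 : (2 * N + 1 : ℝ) * η ≤ 2 * D * a 0 + 3 := by
      have : a 0 / h * η = D * a 0 := by rw [hh]; field_simp
      nlinarith
    calc (2 * N + 1 : ℝ) ^ (m + 1) * η ^ (m + 2 : ℝ) = ((2 * N + 1 : ℝ) * η) ^ (m + 1) * η := by
          rw [e1, mul_pow]; ring
      _ ≤ (2 * D * a 0 + 3) ^ (m + 1) * (ε / (2 * D * a 0 + 3) ^ (m + 1)) := by gcongr
      _ = ε := by field_simp

theorem stmt8 (d : ℕ) (hd : 2 ≤ d) (a : ℕ → ℝ)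
    (ha : StrictAnti a) (hapos : ∀ n, 0 < a n) (halim : Tendsto a atTop (nhds 0))
    (θ : ℝ) (hθ : 0 < θ) (hθ' : θ ≤ 1) :
    (d : ℝ) * lodim θ (Set.range a) ≤ lodim θ (concentricSeq d a) ∧
      (d : ℝ) * updim θ (Set.range a) ≤ updim θ (concentricSeq d a) := by
  obtain ⟨m, rfl⟩ : ∃ m, d = m + 1 := ⟨d - 1, by omega⟩
  have hm : (0 : ℝ) < ((m + 1 : ℕ) : ℝ) := by positivity
  constructor
  · apply le_csInf
    · refine ⟨(m + 2 : ℝ), by positivity, fun ε hε δ₀ hδ₀ => ?_⟩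
      obtain ⟨δ₁, h1, h2⟩ := up_nonempty (m := m) ha hapos hθ hθ' hε
      have hmin : 0 < min δ₀ δ₁ := lt_min hδ₀ h1
      exact ⟨min δ₀ δ₁ / 2, by positivity, by linarith [min_le_left δ₀ δ₁],
        h2 _ (by positivity) (by linarith [min_le_right δ₀ δ₁])⟩
    · rintro s ⟨hs, H⟩
      rw [mul_comm, ← le_div_iff₀ hm]
      apply csInf_le ⟨0, fun x hx => hx.1⟩
      refine ⟨by positivity, fun ε hε δ₀ hδ₀ => ?_⟩
      obtain ⟨ε', hε', δ₁, hδ₁, hk⟩ := key (m := m) ha hapos hθ hθ'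
        (t := s / ((m + 1 : ℕ) : ℝ)) (by positivity) hε
      obtain ⟨δ, h0, h1, h2⟩ := H ε' hε' (min δ₀ δ₁) (lt_min hδ₀ hδ₁)
      refine ⟨δ, h0, h1.trans_le (min_le_left _ _), hk δ h0 (h1.trans_le (min_le_right _ _)) ?_⟩
      have : (m + 1 : ℝ) * (s / ((m + 1 : ℕ) : ℝ)) = s := by push_cast; field_simp
      rw [this]
      exact h2
  · apply le_csInf
    · refine ⟨(m + 2 : ℝ), by positivity, fun ε hε => ?_⟩
      exact up_nonempty (m := m) ha hapos hθ hθ' hε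
    · rintro s ⟨hs, H⟩
      rw [mul_comm, ← le_div_iff₀ hm]
      apply csInf_le ⟨0, fun x hx => hx.1⟩
      refine ⟨by positivity, fun ε hε => ?_⟩
      obtain ⟨ε', hε', δ₁, hδ₁, hk⟩ := key (m := m) ha hapos hθ hθ'
        (t := s / ((m + 1 : ℕ) : ℝ)) (by positivity) hε
      obtain ⟨δ₀, hδ₀, h2⟩ := H ε' hε'
      refine ⟨min δ₀ δ₁, lt_min hδ₀ hδ₁, fun δ h0 h1 => hk δ h0 (h1.trans_le (min_le_right _ _)) ?_⟩
      have : (m + 1 : ℝ) * (s / ((m + 1 : ℕ) : ℝ)) = s := by push_cast; field_simp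
      rw [this]
      exact h2 δ h0 (h1.trans_le (min_le_left _ _))
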